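/- Let B be an n×n complex matrix and suppose that Tr(w(B,Bᴴ)) = 0 for every word w : Fin k → Bool (any k ≥ 1) in which the number of appearances of B differs from the number of appearances of Bᴴ. Then for every t ∈ ℝ there exists a unitary matrix U with e^{it} B = U B Uᴴ. -/

import Mathlib

open Matrix

/-- The Hermitian part `Re B = (B + Bᴴ)/2`. -/
noncomputable def reM {n : ℕ} (B : Matrix (Fin n) (Fin n) ℂ) : Matrix (Fin n) (Fin n) ℂ :=
  (1 / 2 : ℂ) • (B + Bᴴ)

/-- The skew part `Im B = (B - Bᴴ)/(2i)`. -/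
noncomputable def imM {n : ℕ} (B : Matrix (Fin n) (Fin n) ℂ) : Matrix (Fin n) (Fin n) ℂ :=
  (1 / (2 * Complex.I) : ℂ) • (B - Bᴴ)

/-- The pencil `L_B(t) = cos t ⬝ Re B + sin t ⬝ Im B = Re(e^{-it} B)`. -/
noncomputable def LB {n : ℕ} (B : Matrix (Fin n) (Fin n) ℂ) (t : ℝ) :
    Matrix (Fin n) (Fin n) ℂ :=
  (Real.cos t : ℂ) • reM B + (Real.sin t : ℂ) • imM B

/-- The pencil `L_B(t)` is isospectral: its characteristic polynomial is
independent of `t`. -/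
def Isospectral {n : ℕ} (B : Matrix (Fin n) (Fin n) ℂ) : Prop :=
  ∀ s t : ℝ, (LB B s).charpoly = (LB B t).charpoly

/-- The word `w(B, Bᴴ)`: the ordered product over `j = 0, …, k-1` of `Bᴴ` if `w j = true`
and `B` otherwise. -/
noncomputable def wordProd {n : ℕ} (B : Matrix (Fin n) (Fin n) ℂ) {k : ℕ}
    (w : Fin k → Bool) : Matrix (Fin n) (Fin n) ℂ :=
  (List.ofFn fun j => if w j then Bᴴ else B).prod

section WordTraces

open scoped ComplexOrder

variable {n : ℕ}

/-- Every subspace of matrices has a finite Parseval frame for the trace inner product. -/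
lemma exists_trace_frame (S : Submodule ℂ (Matrix (Fin n) (Fin n) ℂ)) :
    ∃ (m : ℕ) (e : Fin m → Matrix (Fin n) (Fin n) ℂ), (∀ i, e i ∈ S) ∧
      ∀ x ∈ S, ∑ i, ((e i)ᴴ * x).trace • e i = x := by
  let _ : NormedAddCommGroup (Matrix (Fin n) (Fin n) ℂ) :=
    Matrix.toMatrixNormedAddCommGroup 1 Matrix.PosDef.one
  let _ : InnerProductSpace ℂ (Matrix (Fin n) (Fin n) ℂ) :=
    Matrix.toMatrixInnerProductSpace 1 Matrix.PosSemidef.one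
  have hinner (x y : Matrix (Fin n) (Fin n) ℂ) : inner ℂ x y = (xᴴ * y).trace := by
    change (y * 1 * xᴴ).trace = _
    rw [mul_one, Matrix.trace_mul_comm]
  let b := stdOrthonormalBasis ℂ S
  refine ⟨_, fun i => (b i : Matrix (Fin n) (Fin n) ℂ), fun i => (b i).2, fun x hx => ?_⟩
  have hsum := congrArg Subtype.val (b.sum_repr' ⟨x, hx⟩)
  simpa [hinner] using hsum

/-- Only finitely many members of a family of trace-orthogonal subspaces are nonzero. -/
lemma finite_ne_bot_of_trace_orthogonal {ι : Type*}
    {S : ι → Submodule ℂ (Matrix (Fin n) (Fin n) ℂ)}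
    (hS : ∀ d e, d ≠ e → ∀ x ∈ S d, ∀ y ∈ S e, (xᴴ * y).trace = 0) :
    {d | S d ≠ ⊥}.Finite := by
  let _ : NormedAddCommGroup (Matrix (Fin n) (Fin n) ℂ) :=
    Matrix.toMatrixNormedAddCommGroup 1 Matrix.PosDef.one
  let _ : InnerProductSpace ℂ (Matrix (Fin n) (Fin n) ℂ) :=
    Matrix.toMatrixInnerProductSpace 1 Matrix.PosSemidef.one
  have hinner (x y : Matrix (Fin n) (Fin n) ℂ) : inner ℂ x y = (xᴴ * y).trace := by
    change (y * 1 * xᴴ).trace = _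
    rw [mul_one, Matrix.trace_mul_comm]
  have horth : OrthogonalFamily ℂ (fun d => S d) fun d => (S d).subtypeₗᵢ := by
    intro d e hde x y
    change inner ℂ (x : Matrix (Fin n) (Fin n) ℂ) y = 0
    rw [hinner]
    exact hS d e hde x x.2 y y.2
  exact WellFoundedGT.finite_ne_bot_of_iSupIndep horth.independent

/-- The Casimir element `∑ eᵢ eᵢᴴ` of a subspace of matrices. -/
noncomputable def casimir (S : Submodule ℂ (Matrix (Fin n) (Fin n) ℂ)) :
    Matrix (Fin n) (Fin n) ℂ :=
  ∑ i, (exists_trace_frame S).choose_spec.choose i *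
    ((exists_trace_frame S).choose_spec.choose i)ᴴ

lemma exists_casimir_eq (S : Submodule ℂ (Matrix (Fin n) (Fin n) ℂ)) :
    ∃ (m : ℕ) (e : Fin m → Matrix (Fin n) (Fin n) ℂ), (∀ i, e i ∈ S) ∧
      (∀ x ∈ S, ∑ i, ((e i)ᴴ * x).trace • e i = x) ∧ casimir S = ∑ i, e i * (e i)ᴴ :=
  ⟨_, _, (exists_trace_frame S).choose_spec.choose_spec.1,
    (exists_trace_frame S).choose_spec.choose_spec.2, rfl⟩

lemma casimir_bot : casimir (⊥ : Submodule ℂ (Matrix (Fin n) (Fin n) ℂ)) = 0 := by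
  obtain ⟨m, e, he, -, hc⟩ := exists_casimir_eq (⊥ : Submodule ℂ (Matrix (Fin n) (Fin n) ℂ))
  rw [hc]
  exact Finset.sum_eq_zero fun i _ => by rw [(Submodule.mem_bot ℂ).1 (he i), zero_mul]

lemma casimir_posSemidef (S : Submodule ℂ (Matrix (Fin n) (Fin n) ℂ)) :
    (casimir S).PosSemidef := by
  obtain ⟨m, e, -, -, hc⟩ := exists_casimir_eq S
  rw [hc]
  exact Matrix.posSemidef_sum _ fun i _ => Matrix.posSemidef_self_mul_conjTranspose (e i)

lemma casimir_posDef {S : Submodule ℂ (Matrix (Fin n) (Fin n) ℂ)} (hS : 1 ∈ S) :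
    (casimir S).PosDef := by
  refine (casimir_posSemidef S).posDef_iff_isUnit.2 ?_
  rw [← Matrix.mulVec_injective_iff_isUnit]
  refine (injective_iff_map_eq_zero (casimir S).mulVecLin).2 fun v hv => ?_
  obtain ⟨m, e, -, hsum, hc⟩ := exists_casimir_eq S
  have hquad : ∑ i, star ((e i)ᴴ *ᵥ v) ⬝ᵥ ((e i)ᴴ *ᵥ v) = 0 := by
    have h0 : star v ⬝ᵥ (casimir S *ᵥ v) = 0 := by
      rw [show casimir S *ᵥ v = 0 from hv, dotProduct_zero]
    rw [hc, Matrix.sum_mulVec, dotProduct_sum] at h0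
    rw [← h0]
    refine Finset.sum_congr rfl fun i _ => ?_
    rw [Matrix.star_mulVec, conjTranspose_conjTranspose, ← Matrix.dotProduct_mulVec,
      Matrix.mulVec_mulVec]
  have hzero (i) : (e i)ᴴ *ᵥ v = 0 := by
    exact dotProduct_star_self_eq_zero.1 ((Finset.sum_eq_zero_iff_of_nonneg
      fun i _ => dotProduct_star_self_nonneg _).1 hquad i (Finset.mem_univ i))
  have hone := congrArg Matrix.conjTranspose (hsum 1 hS)
  rw [conjTranspose_one, conjTranspose_sum] at hone
  rw [← Matrix.one_mulVec v, ← hone, Matrix.sum_mulVec]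
  exact Finset.sum_eq_zero fun i _ => by
    rw [conjTranspose_smul, Matrix.smul_mulVec, hzero, smul_zero]

/-- A matrix mapping `S` to `T`, with adjoint mapping `T` to `S`, intertwines the Casimir
elements of `S` and `T`. -/
lemma mul_casimir {S T : Submodule ℂ (Matrix (Fin n) (Fin n) ℂ)} {B : Matrix (Fin n) (Fin n) ℂ}
    (hST : ∀ x ∈ S, B * x ∈ T) (hTS : ∀ x ∈ T, Bᴴ * x ∈ S) :
    B * casimir S = casimir T * B := by
  obtain ⟨m, e, he, hsumS, hS⟩ := exists_casimir_eq S
  obtain ⟨p, f, hf, hsumT, hT⟩ := exists_casimir_eq T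
  have hleft : B * casimir S = ∑ i, ∑ j, ((f j)ᴴ * (B * e i)).trace • (f j * (e i)ᴴ) := by
    rw [hS, Finset.mul_sum]
    refine Finset.sum_congr rfl fun i _ => ?_
    rw [← mul_assoc, ← hsumT _ (hST _ (he i)), Finset.sum_mul]
    simp only [smul_mul_assoc, hsumT _ (hST _ (he i))]
  have hright : casimir T * B = ∑ j, ∑ i, ((f j)ᴴ * (B * e i)).trace • (f j * (e i)ᴴ) := by
    rw [hT, Finset.sum_mul]
    refine Finset.sum_congr rfl fun j _ => ?_
    have hj : (f j)ᴴ * B = (Bᴴ * f j)ᴴ := by simp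
    rw [mul_assoc, hj, ← hsumS _ (hTS _ (hf j)), conjTranspose_sum, Finset.mul_sum]
    refine Finset.sum_congr rfl fun i _ => ?_
    rw [conjTranspose_smul, mul_smul_comm, ← trace_conjTranspose]
    simp [mul_assoc]
  rw [hleft, hright, Finset.sum_comm]

/-- If left multiplication by `B` has degree one for a trace-orthogonal grading, then `B` is an
eigenvector of eigenvalue one of the commutator with some Hermitian matrix. -/
lemma exists_isHermitian_commutator_eq {B : Matrix (Fin n) (Fin n) ℂ}
    {S : ℤ → Submodule ℂ (Matrix (Fin n) (Fin n) ℂ)}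
    (horth : ∀ d e, d ≠ e → ∀ x ∈ S d, ∀ y ∈ S e, (xᴴ * y).trace = 0)
    (hone : 1 ∈ S 0) (hB : ∀ d, ∀ x ∈ S d, B * x ∈ S (d + 1))
    (hBstar : ∀ d, ∀ x ∈ S (d + 1), Bᴴ * x ∈ S d) :
    ∃ H : Matrix (Fin n) (Fin n) ℂ, H.IsHermitian ∧ H * B - B * H = B := by
  have hsupp : (Function.support fun d => casimir (S d)).Finite := by
    refine (finite_ne_bot_of_trace_orthogonal horth).subset fun d hd hbot => hd ?_
    simp only [hbot, casimir_bot]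
  have hsupp' : (Function.support fun d : ℤ => (d : ℂ) • casimir (S d)).Finite :=
    hsupp.subset fun d hd h0 => hd (by simp only at h0; simp only [h0, smul_zero])
  have hshift (d) : B * casimir (S d) = casimir (S (d + 1)) * B :=
    mul_casimir (hB d) (hBstar d)
  set C := ∑ᶠ d, casimir (S d) with hC
  set K := ∑ᶠ d : ℤ, (d : ℂ) • casimir (S d) with hK
  have hCB : B * C = C * B := by
    rw [hC, mul_finsum' _ _ hsupp, finsum_mul' _ _ hsupp]
    simp only [hshift]
    exact finsum_comp_equiv (Equiv.addRight (1 : ℤ)) (f := fun d => casimir (S d) * B)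
  have hKB : B * K = K * B - C * B := by
    rw [hC, hK, mul_finsum' _ _ hsupp', finsum_mul' _ _ hsupp, finsum_mul' _ _ hsupp',
      ← finsum_sub_distrib
        (hsupp'.subset fun d hd h0 => hd (by simp only at h0; simp only [h0, zero_mul]))
        (hsupp.subset fun d hd h0 => hd (by simp only at h0; simp only [h0, zero_mul])),
      ← finsum_comp_equiv (Equiv.addRight (1 : ℤ))
        (f := fun d : ℤ => (d : ℂ) • casimir (S d) * B - casimir (S d) * B)]
    refine finsum_congr fun d => ?_
    simp [hshift, add_smul, add_mul]
  have hsub : (Function.support fun d => casimir (S d)) ⊆ ↑(insert 0 hsupp.toFinset) := by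
    simp
  have hCpos : C.PosDef := by
    rw [hC, finsum_eq_sum_of_support_subset _ hsub,
      ← Finset.add_sum_erase _ _ (Finset.mem_insert_self 0 _)]
    exact (casimir_posDef hone).add_posSemidef
      (Matrix.posSemidef_sum _ fun d _ => casimir_posSemidef (S d))
  have hKherm : Kᴴ = K := by
    rw [hK, finsum_eq_sum _ hsupp', conjTranspose_sum]
    refine Finset.sum_congr rfl fun d _ => ?_
    rw [conjTranspose_smul, (casimir_posSemidef (S d)).isHermitian.eq]
    simp
  have hu : IsUnit C.det := (Matrix.isUnit_iff_isUnit_det _).1 hCpos.isUnit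
  have hCinv : Commute C⁻¹ B := by
    calc C⁻¹ * B = C⁻¹ * (B * C) * C⁻¹ := by
          rw [mul_assoc, mul_assoc, Matrix.mul_nonsing_inv _ hu, mul_one]
      _ = B * C⁻¹ := by rw [hCB, ← mul_assoc, Matrix.nonsing_inv_mul _ hu, one_mul]
  have hCK : K * B - B * K = C * B := by rw [hKB]; abel
  have hright : K * C⁻¹ * B - B * (K * C⁻¹) = B := by
    calc K * C⁻¹ * B - B * (K * C⁻¹) = (K * B - B * K) * C⁻¹ := by
          rw [mul_assoc, hCinv.eq]; noncomm_ring
      _ = B := by rw [hCK, ← hCB, mul_assoc, Matrix.mul_nonsing_inv _ hu, mul_one]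
  have hleft : C⁻¹ * K * B - B * (C⁻¹ * K) = B := by
    calc C⁻¹ * K * B - B * (C⁻¹ * K) = C⁻¹ * (K * B - B * K) := by
          rw [← mul_assoc B, ← hCinv.eq]; noncomm_ring
      _ = B := by rw [hCK, ← mul_assoc, Matrix.nonsing_inv_mul _ hu, one_mul]
  refine ⟨(1 / 2 : ℂ) • (K * C⁻¹ + C⁻¹ * K), ?_, ?_⟩
  · rw [Matrix.IsHermitian, conjTranspose_smul, conjTranspose_add, conjTranspose_mul,
      conjTranspose_mul, hKherm, hCpos.isHermitian.inv.eq, add_comm]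
    simp
  · rw [smul_mul_assoc, mul_smul_comm, ← smul_sub, add_mul, mul_add, add_sub_add_comm, hright,
      hleft, ← two_smul ℂ B, smul_smul]
    norm_num

lemma exists_unitary_rotation_of_commutator_eq {B H : Matrix (Fin n) (Fin n) ℂ}
    (hH : H.IsHermitian) (hHB : H * B - B * H = B) (t : ℝ) :
    ∃ U : Matrix (Fin n) (Fin n) ℂ,
      U * Uᴴ = 1 ∧ Complex.exp (Complex.I * t) • B = U * B * Uᴴ := by
  set Q : Matrix (Fin n) (Fin n) ℂ := hH.eigenvectorUnitary.1
  have hQ1 : Qᴴ * Q = 1 := Unitary.coe_star_mul_self hH.eigenvectorUnitary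
  have hQ2 : Q * Qᴴ = 1 := Unitary.coe_mul_star_self hH.eigenvectorUnitary
  set D : Matrix (Fin n) (Fin n) ℂ := diagonal fun i => (hH.eigenvalues i : ℂ) with hD
  have hspec : H = Q * D * Qᴴ := hH.spectral_theorem
  set A := Qᴴ * B * Q with hA
  have hBA : B = Q * A * Qᴴ := by
    rw [hA]
    calc B = (Q * Qᴴ) * B * (Q * Qᴴ) := by rw [hQ2, one_mul, mul_one]
      _ = _ := by noncomm_ring
  have hDA : D * A - A * D = A := by
    have hDH : D = Qᴴ * H * Q := by
      rw [hspec]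
      calc D = (Qᴴ * Q) * D * (Qᴴ * Q) := by rw [hQ1, one_mul, mul_one]
        _ = _ := by noncomm_ring
    calc D * A - A * D = Qᴴ * (H * (Q * Qᴴ) * B - B * (Q * Qᴴ) * H) * Q := by
          rw [hDH, hA]; noncomm_ring
      _ = A := by rw [hQ2, mul_one, mul_one, hHB]
  set E : Matrix (Fin n) (Fin n) ℂ :=
    diagonal fun i => Complex.exp (Complex.I * (t * hH.eigenvalues i)) with hE
  have hEstar : Eᴴ = diagonal fun i => Complex.exp (-(Complex.I * (t * hH.eigenvalues i))) := by
    rw [hE, diagonal_conjTranspose]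
    congr 1
    funext i
    simp [← Complex.exp_conj]
  have hEE : E * Eᴴ = 1 := by
    rw [hEstar, hE, diagonal_mul_diagonal, ← diagonal_one]
    congr 1
    funext i
    rw [← Complex.exp_add, add_neg_cancel, Complex.exp_zero]
  have hEA : E * A * Eᴴ = Complex.exp (Complex.I * t) • A := by
    ext i j
    have hij := congrFun (congrFun hDA i) j
    rw [hD, Matrix.sub_apply, diagonal_mul, mul_diagonal] at hij
    rw [hEstar, hE, mul_diagonal, diagonal_mul, Matrix.smul_apply, smul_eq_mul]
    by_cases h0 : A i j = 0
    · simp [h0]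
    have hgap : (hH.eigenvalues i : ℂ) - hH.eigenvalues j = 1 :=
      mul_right_cancel₀ h0 (by linear_combination hij)
    rw [mul_right_comm, ← Complex.exp_add]
    congr 2
    linear_combination Complex.I * t * hgap
  refine ⟨Q * E * Qᴴ, ?_, ?_⟩
  · calc Q * E * Qᴴ * (Q * E * Qᴴ)ᴴ = Q * (E * (Qᴴ * Q) * Eᴴ) * Qᴴ := by
          simp only [conjTranspose_mul, conjTranspose_conjTranspose, mul_assoc]
      _ = 1 := by rw [hQ1, mul_one, hEE, mul_one, hQ2]
  · symm
    calc Q * E * Qᴴ * B * (Q * E * Qᴴ)ᴴ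
        = Q * (E * (Qᴴ * B * Q) * Eᴴ) * Qᴴ := by
          simp only [conjTranspose_mul, conjTranspose_conjTranspose, mul_assoc]
      _ = Complex.exp (Complex.I * t) • B := by
          rw [← hA, hEA, mul_smul_comm, smul_mul_assoc, ← hBA]

/-- The product of the word `l` in `B` (letter `false`) and `Bᴴ` (letter `true`). -/
noncomputable def listWordProd (B : Matrix (Fin n) (Fin n) ℂ) (l : List Bool) :
    Matrix (Fin n) (Fin n) ℂ :=
  (l.map fun b => if b then Bᴴ else B).prod

/-- The span of the words in which `B` appears `d` more times than `Bᴴ`. -/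
noncomputable def wordSpan (B : Matrix (Fin n) (Fin n) ℂ) (d : ℤ) :
    Submodule ℂ (Matrix (Fin n) (Fin n) ℂ) :=
  Submodule.span ℂ (listWordProd B '' {l | (l.count false : ℤ) - l.count true = d})

lemma listWordProd_append (B : Matrix (Fin n) (Fin n) ℂ) (l m : List Bool) :
    listWordProd B (l ++ m) = listWordProd B l * listWordProd B m := by
  simp [listWordProd]

lemma conjTranspose_listWordProd (B : Matrix (Fin n) (Fin n) ℂ) (l : List Bool) :
    (listWordProd B l)ᴴ = listWordProd B (l.reverse.map not) := by
  induction l with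
  | nil => simp [listWordProd]
  | cons b l ih =>
    rw [List.reverse_cons, List.map_append, listWordProd_append, ← ih]
    cases b <;> simp [listWordProd]

lemma count_map_not (l : List Bool) (b : Bool) : (l.map not).count b = l.count (!b) := by
  induction l with
  | nil => rfl
  | cons a l ih => cases a <;> cases b <;> simpa using ih

lemma mul_mem_wordSpan {B : Matrix (Fin n) (Fin n) ℂ} (b : Bool) {d : ℤ}
    {x : Matrix (Fin n) (Fin n) ℂ} (hx : x ∈ wordSpan B d) :
    (if b then Bᴴ else B) * x ∈ wordSpan B (d + if b then -1 else 1) := by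
  induction hx using Submodule.span_induction with
  | mem x hx =>
    obtain ⟨l, hl, rfl⟩ := hx
    refine Submodule.subset_span ⟨b :: l, ?_, by simp [listWordProd]⟩
    rw [Set.mem_ofPred_eq] at hl ⊢
    cases b <;> simp <;> omega
  | zero => simp
  | add x y _ _ hx hy => rw [mul_add]; exact add_mem hx hy
  | smul c x _ hx => rw [mul_smul_comm]; exact Submodule.smul_mem _ c hx

lemma trace_listWordProd_eq_zero {B : Matrix (Fin n) (Fin n) ℂ}
    (h : ∀ (k : ℕ), 1 ≤ k → ∀ w : Fin k → Bool,
      (Finset.univ.filter fun j => w j = false).card ≠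
        (Finset.univ.filter fun j => w j = true).card →
      (wordProd B w).trace = 0)
    {l : List Bool} (hl : l.count false ≠ l.count true) : (listWordProd B l).trace = 0 := by
  have hcount (b : Bool) :
      (Finset.univ.filter fun j : Fin l.length => l.get j = b).card = l.count b :=
    Fin.card_filter_univ_eq_vector_get_eq_count b ⟨l, rfl⟩
  have hpos : 1 ≤ l.length := by
    cases l with
    | nil => simp at hl
    | cons => simp
  have hw := h l.length hpos l.get (by rwa [hcount, hcount])
  have hprod : wordProd B l.get = listWordProd B l := by
    rw [wordProd, listWordProd]
    conv_rhs => rw [← List.ofFn_get l, List.map_ofFn]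
    rfl
  rwa [hprod] at hw

lemma trace_conjTranspose_mul_eq_zero_of_mem_wordSpan {B : Matrix (Fin n) (Fin n) ℂ}
    (h : ∀ l : List Bool, l.count false ≠ l.count true → (listWordProd B l).trace = 0)
    {d e : ℤ} (hde : d ≠ e) {x y : Matrix (Fin n) (Fin n) ℂ}
    (hx : x ∈ wordSpan B d) (hy : y ∈ wordSpan B e) : (xᴴ * y).trace = 0 := by
  induction hx, hy using Submodule.span_induction₂ with
  | mem_mem x y hx hy =>
    obtain ⟨l, hl, rfl⟩ := hx
    obtain ⟨m, hm, rfl⟩ := hy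
    rw [conjTranspose_listWordProd, ← listWordProd_append]
    apply h
    rw [Set.mem_ofPred_eq] at hl hm
    simp only [List.count_append, count_map_not, List.count_reverse, Bool.not_false, Bool.not_true]
    omega
  | zero_left y hy => simp
  | zero_right x hx => simp
  | add_left x y z _ _ _ hx hy => simp [add_mul, hx, hy]
  | add_right x y z _ _ _ hx hy => simp [mul_add, hx, hy]
  | smul_left c x y _ _ hx => simp [hx]
  | smul_right c x y _ _ hx => simp [hx]

end WordTraces

/-- if every word in `B, Bᴴ` (of length `k ≥ 1`) with an unequal number of
appearances of `B` and `Bᴴ` has zero trace, then `e^{it} B` is unitarily similar to `B`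
for every `t`. -/
theorem unbalanced_word_traces_zero_implies_unitary_rotation (n : ℕ)
    (B : Matrix (Fin n) (Fin n) ℂ)
    (h : ∀ (k : ℕ), 1 ≤ k → ∀ w : Fin k → Bool,
      (Finset.univ.filter fun j => w j = false).card ≠
        (Finset.univ.filter fun j => w j = true).card →
      (wordProd B w).trace = 0) :
    ∀ t : ℝ, ∃ U : Matrix (Fin n) (Fin n) ℂ,
      U * Uᴴ = 1 ∧ Complex.exp (Complex.I * t) • B = U * B * Uᴴ := by
  have htrace (l : List Bool) := trace_listWordProd_eq_zero h (l := l)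
  obtain ⟨H, hH, hHB⟩ := exists_isHermitian_commutator_eq (B := B) (S := wordSpan B)
    (fun d e hde x hx y hy =>
      trace_conjTranspose_mul_eq_zero_of_mem_wordSpan htrace hde hx hy)
    (Submodule.subset_span ⟨[], by simp, by simp [listWordProd]⟩)
    (fun d x hx => by simpa using mul_mem_wordSpan false hx)
    (fun d x hx => by simpa using mul_mem_wordSpan true hx)
  exact exists_unitary_rotation_of_commutator_eq hH hHB
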